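/- Let t, u ∈ ℂ with ‖t‖ < 1 and ‖u‖ < 1. Then the iterated normalized contour integral over |z| = 1, |w| = 1 and |z₂| = 1 (each against dμ_{SU(2)}) and over |z₁| = 1 (against dz₁/(2πi z₁)) of PE_F[(z+1/z)(w+1/w); u] · PE_B[z₁(z₂+1/z₂)(z+1/z); t] · PE_B[z₁^{-1}(z₂+1/z₂)(w+1/w); t] equals (1 − t²(u + u³) + u⁴)/(1 − t⁴). This is the Hilbert–Poincaré series of (SO(4)×U(2))-invariant form polynomials for D=4, N=2 flat superspace. -/

import Mathlib

/-- Normalized contour integral `(2πi)⁻¹ ∮_{|z|=1} f(z) dz` over the positively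
oriented unit circle. -/
noncomputable def cint (f : ℂ → ℂ) : ℂ :=
  (2 * (Real.pi : ℂ) * Complex.I)⁻¹ * (∮ z in C(0, 1), f z)

/-- Normalized contour integral `∮ f(z) dz/(2πi z)`. -/
noncomputable def nint (f : ℂ → ℂ) : ℂ :=
  cint fun z => f z / z

/-- Bosonic plethystic exponential `PE_B[χ; t] = ∏_j (1 - t mⱼ)⁻¹`, for `χ` the
sum of the Laurent monomials `mⱼ` in the list `ms`. -/
noncomputable def PE_B (t : ℂ) (ms : List ℂ) : ℂ :=
  ((ms.map fun m => 1 - t * m).prod)⁻¹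

/-- Fermionic plethystic exponential `PE_F[χ; t] = ∏_j (1 - t mⱼ)`. -/
noncomputable def PE_F (t : ℂ) (ms : List ℂ) : ℂ :=
  (ms.map fun m => 1 - t * m).prod

open MeasureTheory Set

/-- The measure `dθ/(2π)` on `(0, 2π]`. -/
noncomputable def angleMeasure : Measure ℝ :=
  ENNReal.ofReal (2 * Real.pi)⁻¹ • volume.restrict (Ioc 0 (2 * Real.pi))

instance isFiniteMeasure_angleMeasure : IsFiniteMeasure angleMeasure := by
  unfold angleMeasure
  exact Measure.smul_finite _ ENNReal.ofReal_ne_top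

theorem nint_eq_intervalIntegral (f : ℂ → ℂ) :
    nint f = ((2 * Real.pi)⁻¹ : ℝ) • ∫ θ in (0 : ℝ)..2 * Real.pi, f (Circle.exp θ) := by
  unfold nint cint circleIntegral
  rw [Complex.real_smul, ← intervalIntegral.integral_const_mul,
    ← intervalIntegral.integral_const_mul]
  refine intervalIntegral.integral_congr fun θ _ => ?_
  have hpi : (Real.pi : ℂ) ≠ 0 := by simp [Real.pi_ne_zero]
  have he : Complex.exp (θ * Complex.I) ≠ 0 := Complex.exp_ne_zero _
  simp only [deriv_circleMap, circleMap_zero, Circle.coe_exp, smul_eq_mul]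
  push_cast
  simp only [one_mul]
  field_simp

theorem nint_eq_integral (f : ℂ → ℂ) :
    nint f = ∫ θ, f (Circle.exp θ) ∂angleMeasure := by
  rw [nint_eq_intervalIntegral, angleMeasure, integral_smul_measure,
    intervalIntegral.integral_of_le Real.two_pi_pos.le, ENNReal.toReal_ofReal
      (inv_nonneg.2 Real.two_pi_pos.le)]

theorem nint_congr {f g : ℂ → ℂ} (h : ∀ z : Circle, f z = g z) : nint f = nint g := by
  simp only [nint_eq_integral, h]

theorem nint_const_mul (c : ℂ) (f : ℂ → ℂ) : nint (fun z => c * f z) = c * nint f := by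
  simp only [nint_eq_integral, integral_const_mul]

theorem integrable_comp_circleExp {X Y : Type*} [TopologicalSpace X] [CompactSpace X]
    [TopologicalSpace Y] [SecondCountableTopology Y] [MeasurableSpace Y] [OpensMeasurableSpace Y]
    {μ : Measure Y} [IsFiniteMeasure μ] {G : X → ℂ} (hG : Continuous G) {e : Y → X}
    (he : Continuous e) : Integrable (fun y => G (e y)) μ := by
  obtain ⟨C, hC⟩ := isCompact_univ.exists_bound_of_continuousOn hG.continuousOn
  exact .of_bound (hG.comp he).aestronglyMeasurable C (.of_forall fun y => hC _ (mem_univ _))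

theorem nint_swap_pairs {F : ℂ → ℂ → ℂ → ℂ → ℂ}
    (hF : Continuous fun p : (Circle × Circle) × (Circle × Circle) =>
      F p.1.1 p.1.2 p.2.1 p.2.2) :
    (nint fun z => nint fun w => nint fun x => nint fun y => F z w x y) =
      nint fun y => nint fun x => nint fun z => nint fun w => F z w x y := by
  simp only [nint_eq_integral]
  set ν := angleMeasure
  let e (p : ℝ × ℝ) : Circle × Circle := (Circle.exp p.1, Circle.exp p.2)
  have he : Continuous e := by fun_prop
  let H (p q : ℝ × ℝ) : ℂ :=
    F (Circle.exp p.1) (Circle.exp p.2) (Circle.exp q.1) (Circle.exp q.2)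
  have hH : Integrable (Function.uncurry H) ((ν.prod ν).prod (ν.prod ν)) :=
    integrable_comp_circleExp hF (e := fun r : (ℝ × ℝ) × (ℝ × ℝ) => (e r.1, e r.2)) (by fun_prop)
  have hr (p : ℝ × ℝ) : Integrable (fun q => H p q) (ν.prod ν) :=
    integrable_comp_circleExp hF (e := fun q : ℝ × ℝ => (e p, e q)) (by fun_prop)
  have hl (q : ℝ × ℝ) : Integrable (fun p => H p q) (ν.prod ν) :=
    integrable_comp_circleExp hF (e := fun p : ℝ × ℝ => (e p, e q)) (by fun_prop)
  have hr' (a b : ℝ) : ∫ q, H (a, b) q ∂ν.prod ν = ∫ c, ∫ d, H (a, b) (c, d) ∂ν ∂ν :=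
    integral_prod _ (hr _)
  have hl' (c d : ℝ) : ∫ p, H p (c, d) ∂ν.prod ν = ∫ a, ∫ b, H (a, b) (c, d) ∂ν ∂ν :=
    integral_prod _ (hl _)
  calc
    _ = ∫ a, ∫ b, ∫ q, H (a, b) q ∂ν.prod ν ∂ν ∂ν := by
      simp only [hr', H]
    _ = ∫ p, ∫ q, H p q ∂ν.prod ν ∂ν.prod ν := (integral_prod _ hH.integral_prod_left).symm
    _ = ∫ q, ∫ p, H p q ∂ν.prod ν ∂ν.prod ν := integral_integral_swap hH
    _ = ∫ d, ∫ c, ∫ p, H p (c, d) ∂ν.prod ν ∂ν ∂ν := integral_prod_symm _ hH.integral_prod_right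
    _ = _ := by simp only [hl', H]

theorem nint_comp_inv (f : ℂ → ℂ) : nint (fun z => f z⁻¹) = nint f := by
  simp only [nint_eq_intervalIntegral]
  congr 1
  have hper : Function.Periodic (fun θ : ℝ => f (Circle.exp θ)) (2 * Real.pi) := fun θ => by
    simp only [Circle.periodic_exp θ]
  have h := intervalIntegral.integral_comp_neg (a := 0) (b := 2 * Real.pi)
    (fun θ : ℝ => f (Circle.exp θ))
  simp only [Circle.exp_neg, Circle.coe_inv, neg_zero] at h
  rw [h]
  simpa using hper.intervalIntegral_add_eq (-(2 * Real.pi)) 0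

theorem nint_of_differentiableOn {p : ℂ → ℂ}
    (hp : DifferentiableOn ℂ p (Metric.closedBall 0 1)) : nint p = p 0 := by
  have h := hp.circleIntegral_sub_inv_smul (w := 0) (by simp)
  simp only [sub_zero, smul_eq_mul] at h
  have hpi : (2 * Real.pi * Complex.I : ℂ) ≠ 0 := by simp [Real.pi_ne_zero, Complex.I_ne_zero]
  simp only [nint, cint, div_eq_inv_mul, h]
  field_simp

theorem nint_add_comp_inv {f p q : ℂ → ℂ} (hp : DifferentiableOn ℂ p (Metric.closedBall 0 1))
    (hq : DifferentiableOn ℂ q (Metric.closedBall 0 1))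
    (h : ∀ z : Circle, f z = p z + q (z : ℂ)⁻¹) : nint f = p 0 + q 0 := by
  have hcont {r : ℂ → ℂ} (hr : DifferentiableOn ℂ r (Metric.closedBall 0 1)) :
      Continuous fun z : Circle => r z :=
    hr.continuousOn.comp_continuous (by fun_prop) fun z => by simp [Circle.norm_coe]
  rw [nint_congr (g := fun z => p z + q z⁻¹) h, ← nint_of_differentiableOn hp,
    ← nint_of_differentiableOn hq, ← nint_comp_inv q]
  simp only [nint_eq_integral]
  refine integral_add (integrable_comp_circleExp (hcont hp) (by fun_prop)) ?_
  simpa using integrable_comp_circleExp (μ := angleMeasure)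
    ((hcont hq).comp (continuous_inv (G := Circle))) Circle.exp.continuous

theorem one_sub_mul_ne_zero {a z : ℂ} (ha : ‖a‖ < 1) (hz : ‖z‖ ≤ 1) : 1 - a * z ≠ 0 := by
  intro h
  have h1 : ‖a * z‖ = 1 := by rw [← sub_eq_zero.1 h, norm_one]
  rw [norm_mul] at h1
  nlinarith [norm_nonneg a, norm_nonneg z]

theorem nint_su2 {a b A B C : ℂ} (ha : ‖a‖ < 1) (hb : ‖b‖ < 1) :
    (nint fun z => (1 - z ^ 2) * (A + B * (z + z⁻¹) + C * (z ^ 2 + (z⁻¹) ^ 2)) *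
      ((1 - a * z) * (1 - a * z⁻¹) * (1 - b * z) * (1 - b * z⁻¹))⁻¹) =
      (A + B * (a + b) + C * (a ^ 2 + a * b + b ^ 2 - 1)) / (1 - a * b) := by
  have hE : DifferentiableOn ℂ (fun z => ((1 - a * z) * (1 - b * z))⁻¹)
      (Metric.closedBall 0 1) := by
    refine DifferentiableOn.inv (by fun_prop) fun z hz => ?_
    have hz' : ‖z‖ ≤ 1 := by simpa using hz
    exact mul_ne_zero (one_sub_mul_ne_zero ha hz') (one_sub_mul_ne_zero hb hz')
  have hab := one_sub_mul_ne_zero ha hb.le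
  rw [nint_add_comp_inv
    (p := fun z => (1 - a * b)⁻¹ * (A * (-z ^ 2 * ((1 - a * z) * (1 - b * z))⁻¹) +
      B * (z - (z ^ 3 + z) * ((1 - a * z) * (1 - b * z))⁻¹) +
      C * (z ^ 2 + (a + b) * z - (z ^ 4 + 1) * ((1 - a * z) * (1 - b * z))⁻¹)))
    (q := fun z => (1 - a * b)⁻¹ * (A * ((1 - a * z) * (1 - b * z))⁻¹ +
      B * (((a + b) - a * b * z + z) * ((1 - a * z) * (1 - b * z))⁻¹) +
      C * ((a ^ 2 + a * b + b ^ 2 - a * b * (a + b) * z + z ^ 2) *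
        ((1 - a * z) * (1 - b * z))⁻¹)))
    (by fun_prop) (by fun_prop) fun z => ?_]
  · simp
    field_simp
    ring
  · have hz := z.coe_ne_zero
    have h1 := one_sub_mul_ne_zero ha z.norm_coe.le
    have h2 := one_sub_mul_ne_zero hb z.norm_coe.le
    have h3 := one_sub_mul_ne_zero ha (z⁻¹).norm_coe.le
    have h4 := one_sub_mul_ne_zero hb (z⁻¹).norm_coe.le
    rw [Circle.coe_inv] at h3 h4
    have h5 : (z : ℂ) - a ≠ 0 := by
      intro h; apply h3; rw [← sub_eq_zero.1 h, mul_inv_cancel₀ hz, sub_self]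
    have h6 : (z : ℂ) - b ≠ 0 := by
      intro h; apply h4; rw [← sub_eq_zero.1 h, mul_inv_cancel₀ hz, sub_self]
    have h7 : 1 - (z : ℂ) * a ≠ 0 := by rwa [mul_comm]
    have h8 : 1 - (z : ℂ) * b ≠ 0 := by rwa [mul_comm]
    field_simp
    ring

theorem nint_su2_haar (A B C : ℂ) :
    (nint fun z => (1 - z ^ 2) *
      (A + B * (z + z⁻¹) ^ 2 + C * (z ^ 2 + 1 + (z⁻¹) ^ 2))) = A + B := by
  rw [nint_add_comp_inv (p := fun z => A * (1 - z ^ 2) + B * (1 - z ^ 2 - z ^ 4) - C * z ^ 4)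
    (q := fun z => B * z ^ 2 + C * z ^ 2) (by fun_prop) (by fun_prop) fun z => ?_]
  · simp
  · have hz := z.coe_ne_zero
    field_simp
    ring

theorem nint_u1 {c : ℂ} (hc : ‖c‖ < 1) :
    (nint fun z => ((1 - c * z ^ 2) * (1 - c * (z⁻¹) ^ 2))⁻¹) = (1 - c ^ 2)⁻¹ := by
  have hne {z : ℂ} (hz : ‖z‖ ≤ 1) : 1 - c * z ^ 2 ≠ 0 :=
    one_sub_mul_ne_zero hc (by rw [norm_pow]; exact pow_le_one₀ (norm_nonneg z) hz)
  have hE : DifferentiableOn ℂ (fun z => (1 - c * z ^ 2)⁻¹) (Metric.closedBall 0 1) :=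
    DifferentiableOn.inv (by fun_prop) fun z hz => hne (by simpa using hz)
  have hc2 : 1 - c ^ 2 ≠ 0 := by simpa [sq] using one_sub_mul_ne_zero hc hc.le
  rw [nint_add_comp_inv (p := fun z => (1 - c ^ 2)⁻¹ * (c * z ^ 2 * (1 - c * z ^ 2)⁻¹))
    (q := fun z => (1 - c ^ 2)⁻¹ * (1 - c * z ^ 2)⁻¹) (by fun_prop) (by fun_prop) fun z => ?_]
  · simp
  · have hz := z.coe_ne_zero
    have h1 := hne z.norm_coe.le
    have h2 := hne (z⁻¹).norm_coe.le
    rw [Circle.coe_inv] at h2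
    have h3 : (z : ℂ) * (z : ℂ)⁻¹ = 1 := mul_inv_cancel₀ hz
    generalize (z : ℂ)⁻¹ = v at *
    field_simp
    linear_combination (c ^ 2 * ((z : ℂ) * v + 1)) * h3

theorem continuous_PE_F {X : Type*} [TopologicalSpace X] (u : ℂ)
    {m₁ m₂ m₃ m₄ : X → Circle} (h₁ : Continuous m₁) (h₂ : Continuous m₂) (h₃ : Continuous m₃)
    (h₄ : Continuous m₄) :
    Continuous fun x => PE_F u [(m₁ x : ℂ), (m₂ x : ℂ), (m₃ x : ℂ), (m₄ x : ℂ)] := by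
  simp only [PE_F, List.map_cons, List.map_nil, List.prod_cons, List.prod_nil]
  fun_prop

theorem continuous_PE_B {X : Type*} [TopologicalSpace X] {t : ℂ} (ht : ‖t‖ < 1)
    {m₁ m₂ m₃ m₄ : X → Circle} (h₁ : Continuous m₁) (h₂ : Continuous m₂) (h₃ : Continuous m₃)
    (h₄ : Continuous m₄) :
    Continuous fun x => PE_B t [(m₁ x : ℂ), (m₂ x : ℂ), (m₃ x : ℂ), (m₄ x : ℂ)] := by
  have hne (z : Circle) : 1 - t * z ≠ 0 := one_sub_mul_ne_zero ht z.norm_coe.le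
  simp only [PE_B, List.map_cons, List.map_nil, List.prod_cons, List.prod_nil]
  refine Continuous.inv₀ (by fun_prop) fun x => ?_
  simp [hne]

theorem nint_spin4 {t : ℂ} (u : ℂ) (ht : ‖t‖ < 1) (x y : Circle) :
    (nint fun z => nint fun w => (1 - z ^ 2) * ((1 - w ^ 2) *
      (PE_F u [z * w, z / w, w / z, 1 / (z * w)] *
        PE_B t [y * x * z, y * x / z, y * z / x, y / (x * z)] *
        PE_B t [x * w / y, x / (y * w), w / (y * x), 1 / (y * x * w)]))) =
      (1 + u ^ 4 - (u + u ^ 3) * t ^ 2 * (x + (x : ℂ)⁻¹) ^ 2 +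
        u ^ 2 * t ^ 2 * (y ^ 2 + (y : ℂ)⁻¹ ^ 2) * (x ^ 2 + 1 + (x : ℂ)⁻¹ ^ 2)) *
      ((1 - t ^ 2 * y ^ 2) * (1 - t ^ 2 * (y : ℂ)⁻¹ ^ 2))⁻¹ := by
  have hx := x.coe_ne_zero
  have hy := y.coe_ne_zero
  have hn (m : Circle) : ‖t * m‖ < 1 := by simpa [Circle.norm_coe] using ht
  rw [nint_congr (g := fun z =>
      (1 - (t * ↑(x / y)) * (t * ↑(y * x)⁻¹))⁻¹ * ((1 - z ^ 2) *
        ((1 + u ^ 4 + 2 * u ^ 2 + u ^ 2 *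
            ((t * ↑(x / y)) ^ 2 + (t * ↑(x / y)) * (t * ↑(y * x)⁻¹) + (t * ↑(y * x)⁻¹) ^ 2 - 1)) +
          (-(u + u ^ 3) * (t * ↑(x / y) + t * ↑(y * x)⁻¹)) * (z + z⁻¹) +
          u ^ 2 * (z ^ 2 + z⁻¹ ^ 2)) *
        ((1 - t * ↑(y * x) * z) * (1 - t * ↑(y * x) * z⁻¹) * (1 - t * ↑(y / x) * z) *
          (1 - t * ↑(y / x) * z⁻¹))⁻¹)) fun z => ?_,
    nint_const_mul, nint_su2 (hn _) (hn _)]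
  · have e1 : t * ↑(x / y) * (t * ↑(y * x)⁻¹) = t ^ 2 * (y : ℂ)⁻¹ ^ 2 := by
      simp only [Circle.coe_mul, Circle.coe_div, Circle.coe_inv]
      field_simp
    have e2 : t * ↑(y * x) * (t * ↑(y / x)) = t ^ 2 * (y : ℂ) ^ 2 := by
      simp only [Circle.coe_mul, Circle.coe_div]
      field_simp
    rw [e1, e2, div_eq_mul_inv, mul_inv, mul_left_comm, mul_comm (1 - t ^ 2 * (y : ℂ)⁻¹ ^ 2)⁻¹,
      mul_assoc]
    congr 1
    · simp only [Circle.coe_mul, Circle.coe_div, Circle.coe_inv]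
      field_simp
      ring
    · rw [mul_inv]
  · have hz := z.coe_ne_zero
    rw [nint_congr (g := fun w => (1 - (z : ℂ) ^ 2) *
        ((1 - t * ↑(y * x) * z) * (1 - t * ↑(y * x) * (z : ℂ)⁻¹) * (1 - t * ↑(y / x) * z) *
          (1 - t * ↑(y / x) * (z : ℂ)⁻¹))⁻¹ * ((1 - w ^ 2) *
        ((1 + u ^ 4 + 2 * u ^ 2 + u ^ 2 * (z ^ 2 + (z : ℂ)⁻¹ ^ 2)) +
          (-(u + u ^ 3) * (z + (z : ℂ)⁻¹)) * (w + w⁻¹) + u ^ 2 * (w ^ 2 + w⁻¹ ^ 2)) *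
        ((1 - t * ↑(x / y) * w) * (1 - t * ↑(x / y) * w⁻¹) * (1 - t * ↑(y * x)⁻¹ * w) *
          (1 - t * ↑(y * x)⁻¹ * w⁻¹))⁻¹)) fun w => ?_,
      nint_const_mul, nint_su2 (hn _) (hn _)]
    · ring
    · have hw := w.coe_ne_zero
      have hF : PE_F u [(z : ℂ) * w, z / w, w / z, 1 / (z * w)] =
          (1 + u ^ 4 + 2 * u ^ 2 + u ^ 2 * (z ^ 2 + (z : ℂ)⁻¹ ^ 2)) +
          (-(u + u ^ 3) * (z + (z : ℂ)⁻¹)) * (w + (w : ℂ)⁻¹) +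
          u ^ 2 * (w ^ 2 + (w : ℂ)⁻¹ ^ 2) := by
        simp only [PE_F, List.map_cons, List.map_nil, List.prod_cons, List.prod_nil]
        field_simp
        ring
      have hB : PE_B t [(y : ℂ) * x * z, y * x / z, y * z / x, y / (x * z)] =
          ((1 - t * ↑(y * x) * z) * (1 - t * ↑(y * x) * (z : ℂ)⁻¹) * (1 - t * ↑(y / x) * z) *
            (1 - t * ↑(y / x) * (z : ℂ)⁻¹))⁻¹ := by
        simp only [PE_B, List.map_cons, List.map_nil, List.prod_cons, List.prod_nil,
          Circle.coe_mul, Circle.coe_div]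
        congr 1
        ring
      have hB' : PE_B t [(x : ℂ) * w / y, x / (y * w), w / (y * x), 1 / (y * x * w)] =
          ((1 - t * ↑(x / y) * w) * (1 - t * ↑(x / y) * (w : ℂ)⁻¹) * (1 - t * ↑(y * x)⁻¹ * w) *
            (1 - t * ↑(y * x)⁻¹ * (w : ℂ)⁻¹))⁻¹ := by
        simp only [PE_B, List.map_cons, List.map_nil, List.prod_cons, List.prod_nil,
          Circle.coe_mul, Circle.coe_div, Circle.coe_inv]
        congr 1
        ring
      rw [hF, hB, hB']
      ring

/-- Hilbert–Poincaré series of `(SO(4)×U(2))`-invariant form polynomials for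
`D=4`, `N=2` flat superspace. -/
theorem statement_3 (t u : ℂ) (ht : ‖t‖ < 1) (hu : ‖u‖ < 1) :
    (nint fun z => (1 - z ^ 2) *
      nint fun w => (1 - w ^ 2) *
        nint fun z₂ => (1 - z₂ ^ 2) *
          nint fun z₁ =>
            PE_F u [z * w, z / w, w / z, 1 / (z * w)] *
            PE_B t [z₁ * z₂ * z, z₁ * z₂ / z, z₁ * z / z₂, z₁ / (z₂ * z)] *
            PE_B t [z₂ * w / z₁, z₂ / (z₁ * w), w / (z₁ * z₂), 1 / (z₁ * z₂ * w)])
      = (1 - t ^ 2 * (u + u ^ 3) + u ^ 4) / (1 - t ^ 4) := by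
  simp only [← nint_const_mul]
  rw [nint_swap_pairs]
  · have hzw (x y : Circle) := nint_spin4 u ht x y
    have hx (y : Circle) :
        (nint fun x => nint fun z => nint fun w => (1 - z ^ 2) * ((1 - w ^ 2) * ((1 - x ^ 2) *
          (PE_F u [z * w, z / w, w / z, 1 / (z * w)] *
            PE_B t [y * x * z, y * x / z, y * z / x, y / (x * z)] *
            PE_B t [x * w / y, x / (y * w), w / (y * x), 1 / (y * x * w)])))) =
        (1 - t ^ 2 * (u + u ^ 3) + u ^ 4) *
          ((1 - t ^ 2 * y ^ 2) * (1 - t ^ 2 * (y : ℂ)⁻¹ ^ 2))⁻¹ := by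
      rw [nint_congr (g := fun x => ((1 - t ^ 2 * (y : ℂ) ^ 2) * (1 - t ^ 2 * (y : ℂ)⁻¹ ^ 2))⁻¹ *
        ((1 - x ^ 2) * ((1 + u ^ 4) + (-(u + u ^ 3) * t ^ 2) * (x + x⁻¹) ^ 2 +
          (u ^ 2 * t ^ 2 * ((y : ℂ) ^ 2 + (y : ℂ)⁻¹ ^ 2)) * (x ^ 2 + 1 + x⁻¹ ^ 2))))
          fun x => ?_, nint_const_mul, nint_su2_haar]
      · ring
      · simp only [mul_left_comm _ (1 - (x : ℂ) ^ 2), nint_const_mul (1 - (x : ℂ) ^ 2), hzw]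
        ring
    rw [nint_congr (g := fun y => (1 - t ^ 2 * (u + u ^ 3) + u ^ 4) *
        ((1 - t ^ 2 * y ^ 2) * (1 - t ^ 2 * y⁻¹ ^ 2))⁻¹) hx, nint_const_mul,
      nint_u1 (by simpa using pow_lt_one₀ (norm_nonneg t) ht two_ne_zero), div_eq_mul_inv, ← pow_mul]
  · refine .mul (by fun_prop) (.mul (by fun_prop) (.mul (by fun_prop) (.mul (.mul ?_ ?_) ?_)))
    · simp only [← Circle.coe_mul, ← Circle.coe_div, ← Circle.coe_one]
      exact continuous_PE_F u (by fun_prop) (by fun_prop) (by fun_prop) (by fun_prop)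
    · simp only [← Circle.coe_mul, ← Circle.coe_div]
      exact continuous_PE_B ht (by fun_prop) (by fun_prop) (by fun_prop) (by fun_prop)
    · simp only [← Circle.coe_mul, ← Circle.coe_div, ← Circle.coe_one]
      exact continuous_PE_B ht (by fun_prop) (by fun_prop) (by fun_prop) (by fun_prop)
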